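/- Let s, k ∈ ℂ be such that 2s ∉ ℤ, s+k ∉ ℤ and s−k ∉ ℤ. Then (Γ(s−k)·Γ(−s−k)·Γ(s+k)·Γ(−s+k)) / (Γ(s−1/2)·Γ(−s−1/2)·Γ(s)·Γ(−s)) · ((s+k)(s−k)) / (s²·(s−1/2)·(s+1/2)) = sin(πs)·cos(πs) / (s · sin(π(s−k)) · sin(π(s+k))). -/

import Mathlib

open Complex

/-- Euler's reflection formula in symmetric form. -/
theorem gamma_mul_gamma_neg {w : ℂ} (hw : w ≠ 0) :
    Gamma w * Gamma (-w) = -(Real.pi / (w * sin (Real.pi * w))) := by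
  have h := Gamma_mul_Gamma_one_sub w
  rw [sub_eq_neg_add, Gamma_add_one _ (neg_ne_zero.mpr hw)] at h
  rw [mul_comm w, ← div_div, ← h]
  field_simp

/-- Euler's reflection formula at `s + 1 / 2`, shifted to the arguments `± s - 1 / 2`. -/
theorem gamma_sub_half_mul_gamma_neg_sub_half {s : ℂ} (h : s - 1 / 2 ≠ 0) (h' : s + 1 / 2 ≠ 0) :
    Gamma (s - 1 / 2) * Gamma (-s - 1 / 2) =
      -(Real.pi / ((s - 1 / 2) * (s + 1 / 2) * cos (Real.pi * s))) := by
  have h'' : -s - 1 / 2 ≠ 0 := by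
    rw [← neg_add']
    exact neg_ne_zero.mpr h'
  have e := Gamma_mul_Gamma_one_sub (s + 1 / 2)
  rw [show s + 1 / 2 = s - 1 / 2 + 1 by ring, Gamma_add_one _ h,
    show 1 - (s - 1 / 2 + 1) = -s - 1 / 2 + 1 by ring, Gamma_add_one _ h'',
    show (Real.pi : ℂ) * (s - 1 / 2 + 1) = Real.pi * s + Real.pi / 2 by ring,
    sin_add_pi_div_two] at e
  rw [mul_comm ((s - 1 / 2) * (s + 1 / 2)), ← div_div, ← e, ← neg_div,
    eq_div_iff (mul_ne_zero h h')]
  ring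

/-- The Gamma-to-sine identity from the proof of Corollary 3.2: for `s, k ∈ ℂ` with
`2s ∉ ℤ`, `s+k ∉ ℤ` and `s−k ∉ ℤ`,
`(Γ(s−k)Γ(−s−k)Γ(s+k)Γ(−s+k)) / (Γ(s−1/2)Γ(−s−1/2)Γ(s)Γ(−s)) · ((s+k)(s−k))/(s²(s−1/2)(s+1/2))
  = sin(πs)cos(πs) / (s·sin(π(s−k))·sin(π(s+k)))`. -/
theorem gamma_ratio_eq_sin_cos (s k : ℂ) (h1 : ∀ n : ℤ, 2 * s ≠ (n : ℂ))
    (h2 : ∀ n : ℤ, s + k ≠ (n : ℂ)) (h3 : ∀ n : ℤ, s - k ≠ (n : ℂ)) :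
    (Complex.Gamma (s - k) * Complex.Gamma (-s - k) * Complex.Gamma (s + k) *
          Complex.Gamma (-s + k)) /
        (Complex.Gamma (s - 1 / 2) * Complex.Gamma (-s - 1 / 2) * Complex.Gamma s *
          Complex.Gamma (-s)) *
        ((s + k) * (s - k) / (s ^ 2 * (s - 1 / 2) * (s + 1 / 2))) =
      Complex.sin ((Real.pi : ℂ) * s) * Complex.cos ((Real.pi : ℂ) * s) /
        (s * Complex.sin ((Real.pi : ℂ) * (s - k)) *
          Complex.sin ((Real.pi : ℂ) * (s + k))) := by
  have hs : s ≠ 0 := fun h => h1 0 (by simp [h])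
  have hm : s - 1 / 2 ≠ 0 := fun h => h1 1 (by push_cast; linear_combination 2 * h)
  have hp : s + 1 / 2 ≠ 0 := fun h => h1 (-1) (by push_cast; linear_combination 2 * h)
  have ha : s + k ≠ 0 := by simpa using h2 0
  have hb : s - k ≠ 0 := by simpa using h3 0
  have hsa : sin (Real.pi * (s + k)) ≠ 0 := sin_pi_mul_ne_zero (fun ⟨n, hn⟩ => h2 n hn.symm)
  have hsb : sin (Real.pi * (s - k)) ≠ 0 := sin_pi_mul_ne_zero (fun ⟨n, hn⟩ => h3 n hn.symm)
  have hsc : sin (Real.pi * s) ≠ 0 ∧ cos (Real.pi * s) ≠ 0 := by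
    have h : sin (Real.pi * (2 * s)) ≠ 0 := sin_pi_mul_ne_zero (fun ⟨n, hn⟩ => h1 n hn.symm)
    rw [show (Real.pi : ℂ) * (2 * s) = 2 * (Real.pi * s) by ring, sin_two_mul] at h
    exact ⟨right_ne_zero_of_mul (left_ne_zero_of_mul h), right_ne_zero_of_mul h⟩
  obtain ⟨hsin, hcos⟩ := hsc
  have hnum : Gamma (s - k) * Gamma (-s - k) * Gamma (s + k) * Gamma (-s + k) =
      (Gamma (s - k) * Gamma (-(s - k))) * (Gamma (s + k) * Gamma (-(s + k))) := by
    rw [show -(s - k) = -s + k by ring, show -(s + k) = -s - k by ring]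
    ring
  rw [hnum, gamma_mul_gamma_neg hb, gamma_mul_gamma_neg ha, mul_assoc _ (Gamma s),
    gamma_mul_gamma_neg hs, gamma_sub_half_mul_gamma_neg_sub_half hm hp]
  generalize sin (Real.pi * s) = x at *
  generalize cos (Real.pi * s) = y at *
  generalize sin (Real.pi * (s + k)) = u at *
  generalize sin (Real.pi * (s - k)) = v at *
  generalize s - 1 / 2 = a at *
  generalize s + 1 / 2 = b at *
  field_simp
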